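/- Let k ≤ n be positive integers and let m = (m₁, m₂, …, m_n) be an n-tuple of positive integers with at most k parts equal to 1. Then |E(m)| ≤ 2^{78k} · |m|!. -/

import Mathlib

open Nat Finset

attribute [local instance] Classical.propDecidable

/-- The series `ζ(k) = Σ_{j=1}^∞ j^{−k}` (convergent for `k ≥ 2`). -/
noncomputable def zetaSeries (k : ℤ) : ℝ :=
  ∑' j : ℕ, ((j : ℝ) + 1) ^ (-k)

/-- `𝔷(k) = (2 − 2^{2−k}) ζ(k)` for even integers `k ≥ 2`, `𝔷(0) = 1`, and `𝔷(k) = 0`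
for all other integers `k` (in particular for odd or negative `k`). -/
noncomputable def zed (k : ℤ) : ℝ :=
  if k = 0 then 1
  else if 2 ≤ k ∧ Even k then (2 - (2 : ℝ) ^ (2 - k)) * zetaSeries k
  else 0

/-- `P` is a (reduced) set partition of the finite set `S`: a collection of nonempty
disjoint subsets of `S` whose union is `S` (each element of `S` lies in exactly one
component). -/
def IsSetPartitionOn {ι : Type*} [DecidableEq ι] (S : Finset ι) (P : Finset (Finset ι)) :
    Prop :=
  (∀ s ∈ P, s ⊆ S ∧ s ≠ ∅) ∧ ∀ x ∈ S, ∃! s, s ∈ P ∧ x ∈ s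

/-- The quantity `E(m)` of Eskin–Okounkov, for a weight function `v` on a finite ground
set `S`:
`E = Σ_{P partition of S, ℓ(P) ≥ 2} (−1)^{ℓ(P)−1} (ℓ(P)−2)!
      Σ_{d : P → ℕ, Σ d = ℓ(P)−2} ∏_{s ∈ P} (1/d_s!) · |v_s|! · 𝔷(|v_s| − |s| − d_s + 1)`,
where `|v_s| = Σ_{x ∈ s} v(x)` and `|s|` is the cardinality of the component `s`. -/
noncomputable def Emap {ι : Type*} [Fintype ι] [DecidableEq ι]
    (S : Finset ι) (v : ι → ℕ) : ℝ :=
  ∑ P ∈ Finset.univ.filter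
      (fun P : Finset (Finset ι) => IsSetPartitionOn S P ∧ 2 ≤ P.card),
    (-1 : ℝ) ^ (P.card - 1) * ((P.card - 2)! : ℝ) *
      ∑ d ∈ Finset.finsuppAntidiag P (P.card - 2),
        ∏ s ∈ P,
          (1 / ((d s)! : ℝ) * ((∑ x ∈ s, v x)! : ℝ) *
            zed ((∑ x ∈ s, v x : ℤ) - s.card - d s + 1))

lemma summable_zetaSeries {k : ℕ} (hk : 2 ≤ k) :
    Summable fun j : ℕ => ((j : ℝ) + 1) ^ (-(k : ℤ)) := by
  have h := (summable_nat_add_iff 1).2 (Real.summable_one_div_nat_pow.2 (show 1 < k by lia))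
  refine h.congr fun j => ?_
  simp [zpow_neg]

lemma abs_zed_le_two (k : ℤ) : |zed k| ≤ 2 := by
  unfold zed
  split_ifs with h0 h2
  · norm_num
  · obtain ⟨K, rfl⟩ := Int.eq_ofNat_of_zero_le (show 0 ≤ k by lia)
    have hK : 2 ≤ K := by exact_mod_cast h2.1
    set f : ℕ → ℝ := fun j => ((j : ℝ) + 1) ^ (-(K : ℤ)) with hf
    have hs : Summable f := summable_zetaSeries hK
    have ho : Summable fun j => f (2 * j) :=
      hs.comp_injective (fun a b h => by simpa using h)
    have he : Summable fun j => f (2 * j + 1) :=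
      hs.comp_injective (fun a b h => by simpa using h)
    have hsplit := tsum_even_add_odd ho he
    have hshift : ∑' j, f (2 * j) ≤ 1 + ∑' j, f (2 * j + 1) := by
      rw [ho.tsum_eq_zero_add]
      refine add_le_add (by simp [hf]) (Summable.tsum_le_tsum (fun j => ?_)
        ((summable_nat_add_iff 1).2 ho) he)
      simp only [hf, zpow_neg, zpow_natCast]
      push_cast
      gcongr
      linarith
    have heven : ∑' j, f (2 * j + 1) = (2 : ℝ) ^ (-(K : ℤ)) * ∑' j, f j := by
      rw [← tsum_mul_left]
      refine tsum_congr fun j => ?_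
      simp only [hf]
      rw [← mul_zpow]
      congr 1
      push_cast
      ring
    have hZ : 0 ≤ ∑' j, f j := tsum_nonneg fun j => by positivity
    have hpow : (2 : ℝ) ^ (2 - (K : ℤ)) = 4 * (2 : ℝ) ^ (-(K : ℤ)) := by
      rw [sub_eq_add_neg, zpow_add₀ two_ne_zero]
      norm_num
    have hle : (2 : ℝ) ^ (-(K : ℤ)) ≤ 1 / 4 := by
      calc (2 : ℝ) ^ (-(K : ℤ)) ≤ 2 ^ (-2 : ℤ) :=
            zpow_le_zpow_right₀ one_le_two (by lia)
        _ = 1 / 4 := by norm_num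
    have hdef : zetaSeries (K : ℤ) = ∑' j, f j := rfl
    rw [hdef, hpow, abs_of_nonneg (mul_nonneg (by linarith) hZ)]
    rw [heven] at hsplit hshift
    nlinarith
  · norm_num

lemma factorial_mul_sum_finsuppAntidiag {κ : Type*} (s : Finset κ) (n : ℕ) :
    (n ! : ℝ) * ∑ d ∈ Finset.finsuppAntidiag s n, ∏ i ∈ s, (1 / ((d i)! : ℝ)) =
      (s.card : ℝ) ^ n := by
  have h := Finset.sum_pow_eq_sum_piAntidiag s (fun _ => (1 : ℝ)) n
  simp only [Finset.sum_const, nsmul_eq_mul, mul_one, one_pow, Finset.prod_const_one] at h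
  rw [h, Finset.mul_sum]
  refine Finset.sum_bij (fun d _ => ⇑d) (fun d hd => ?_) (fun a _ b _ hab => DFunLike.coe_injective hab)
    (fun g hg => ?_) (fun d hd => ?_)
  · rw [Finset.mem_finsuppAntidiag] at hd
    exact Finset.mem_piAntidiag.2 ⟨hd.1, fun i hi => hd.2 (Finsupp.mem_support_iff.2 hi)⟩
  · rw [Finset.mem_piAntidiag] at hg
    refine ⟨Finsupp.onFinset s g hg.2, ?_, rfl⟩
    rw [Finset.mem_finsuppAntidiag]
    exact ⟨hg.1, Finsupp.support_onFinset_subset⟩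
  · rw [Finset.mem_finsuppAntidiag] at hd
    have hm := Nat.multinomial_spec s d
    rw [hd.1] at hm
    rw [← hm, Finset.prod_div_distrib]
    push_cast
    have : ∏ i ∈ s, ((d i)! : ℝ) ≠ 0 := by positivity
    field_simp
    simp

lemma pow_le_three_pow_mul_factorial (r : ℕ) : (r : ℝ) ^ (r - 2) ≤ 3 ^ r * (r ! : ℝ) := by
  obtain rfl | hr := Nat.eq_zero_or_pos r
  · simp
  have hr1 : (1 : ℝ) ≤ r := by exact_mod_cast hr
  have h1 := Real.pow_div_factorial_le_exp (x := r) (by positivity) r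
  have h2 : Real.exp r ≤ 3 ^ r := by
    rw [← Real.exp_one_pow]
    exact pow_le_pow_left₀ (Real.exp_pos 1).le Real.exp_one_lt_three.le r
  rw [div_le_iff₀ (by positivity)] at h1
  calc (r : ℝ) ^ (r - 2) ≤ (r : ℝ) ^ r := pow_le_pow_right₀ hr1 (Nat.sub_le r 2)
    _ ≤ _ := h1.trans (by gcongr)

/-- Each set partition `P` of `S`, weighted by the number of orderings of its components and by a
multiplicative weight. -/
noncomputable def orderedPartitionSum {ι : Type*} [Fintype ι] [DecidableEq ι]
    (f : Finset ι → ℝ) (S : Finset ι) : ℝ :=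
  ∑ P ∈ Finset.univ.filter (fun P : Finset (Finset ι) => IsSetPartitionOn S P),
    (P.card ! : ℝ) * ∏ s ∈ P, f s

lemma abs_Emap_le_orderedPartitionSum {ι : Type*} [Fintype ι] [DecidableEq ι]
    (S : Finset ι) (v : ι → ℕ) :
    |Emap S v| ≤ orderedPartitionSum (fun s => 6 * ((∑ x ∈ s, v x)! : ℝ)) S := by
  unfold Emap orderedPartitionSum
  refine (Finset.abs_sum_le_sum_abs _ _).trans ?_
  refine (Finset.sum_le_sum (g := fun P => (P.card ! : ℝ) * ∏ s ∈ P, (6 * ((∑ x ∈ s, v x)! : ℝ)))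
    fun P hP => ?_).trans
    (Finset.sum_le_sum_of_subset_of_nonneg (fun P hP => ?_) fun P _ _ => by positivity)
  · rw [abs_mul, abs_mul, abs_pow, abs_neg, abs_one, one_pow, one_mul, Nat.abs_cast]
    have hd : ∀ d ∈ Finset.finsuppAntidiag P (P.card - 2),
        |∏ s ∈ P, (1 / ((d s)! : ℝ) * ((∑ x ∈ s, v x)! : ℝ) *
          zed ((∑ x ∈ s, v x : ℤ) - s.card - d s + 1))| ≤
        (∏ s ∈ P, (1 / ((d s)! : ℝ))) * ∏ s ∈ P, (2 * ((∑ x ∈ s, v x)! : ℝ)) := by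
      intro d _
      rw [Finset.abs_prod, ← Finset.prod_mul_distrib]
      refine Finset.prod_le_prod (fun _ _ => abs_nonneg _) fun s _ => ?_
      rw [abs_mul, abs_of_nonneg (by positivity), mul_comm (2 : ℝ), ← mul_assoc]
      exact mul_le_mul_of_nonneg_left (abs_zed_le_two _) (by positivity)
    calc _ ≤ ((P.card - 2)! : ℝ) * ∑ d ∈ Finset.finsuppAntidiag P (P.card - 2),
          (∏ s ∈ P, (1 / ((d s)! : ℝ))) * ∏ s ∈ P, (2 * ((∑ x ∈ s, v x)! : ℝ)) := by
          refine mul_le_mul_of_nonneg_left ?_ (by positivity)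
          exact (Finset.abs_sum_le_sum_abs _ _).trans (Finset.sum_le_sum hd)
      _ = (P.card : ℝ) ^ (P.card - 2) * ∏ s ∈ P, (2 * ((∑ x ∈ s, v x)! : ℝ)) := by
          rw [← Finset.sum_mul, ← mul_assoc]
          congr 1
          convert factorial_mul_sum_finsuppAntidiag P (P.card - 2)
      _ ≤ (3 ^ P.card * (P.card ! : ℝ)) * ∏ s ∈ P, (2 * ((∑ x ∈ s, v x)! : ℝ)) :=
          mul_le_mul_of_nonneg_right (pow_le_three_pow_mul_factorial _) (by positivity)
      _ = _ := by
          simp only [Finset.prod_mul_distrib, Finset.prod_const]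
          rw [show (6 : ℝ) = 3 * 2 by norm_num, mul_pow]
          ring
  · simp only [Finset.mem_filter, Finset.mem_univ, true_and] at hP ⊢
    exact hP.1

lemma orderedPartitionSum_empty {ι : Type*} [Fintype ι] [DecidableEq ι] (f : Finset ι → ℝ) :
    orderedPartitionSum f ∅ = 1 := by
  unfold orderedPartitionSum
  have : Finset.univ.filter (fun P : Finset (Finset ι) => IsSetPartitionOn ∅ P) = {∅} := by
    ext P
    simp only [Finset.mem_filter, Finset.mem_univ, true_and, Finset.mem_singleton]
    constructor
    · intro h
      refine Finset.eq_empty_of_forall_notMem fun s hs => ?_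
      exact (h.1 s hs).2 (Finset.subset_empty.1 (h.1 s hs).1)
    · rintro rfl
      exact ⟨by simp, by simp⟩
  rw [this]
  simp

lemma IsSetPartitionOn.erase {ι : Type*} [DecidableEq ι] {S : Finset ι} {P : Finset (Finset ι)} (hP : IsSetPartitionOn S P)
    {s : Finset ι} (hs : s ∈ P) : IsSetPartitionOn (S \ s) (P.erase s) := by
  refine ⟨fun t ht => ?_, fun x hx => ?_⟩
  · rw [Finset.mem_erase] at ht
    refine ⟨fun x hx => ?_, (hP.1 t ht.2).2⟩
    have hxS := (hP.1 t ht.2).1 hx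
    refine Finset.mem_sdiff.2 ⟨hxS, fun hxs => ht.1 ?_⟩
    exact (hP.2 x hxS).unique ⟨ht.2, hx⟩ ⟨hs, hxs⟩
  · rw [Finset.mem_sdiff] at hx
    obtain ⟨t, ⟨htP, hxt⟩, huniq⟩ := hP.2 x hx.1
    refine ⟨t, ⟨Finset.mem_erase.2 ⟨?_, htP⟩, hxt⟩, fun u hu => ?_⟩
    · rintro rfl
      exact hx.2 hxt
    · exact huniq u ⟨Finset.mem_of_mem_erase hu.1, hu.2⟩

lemma IsSetPartitionOn.notMem_of_sdiff {ι : Type*} [DecidableEq ι] {S s : Finset ι} {Q : Finset (Finset ι)}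
    (hQ : IsSetPartitionOn (S \ s) Q) (hs : s ≠ ∅) : s ∉ Q := by
  intro h
  obtain ⟨x, hx⟩ := Finset.nonempty_iff_ne_empty.2 hs
  exact (Finset.mem_sdiff.1 ((hQ.1 s h).1 hx)).2 hx

lemma IsSetPartitionOn.insert {ι : Type*} [DecidableEq ι] {S s : Finset ι} {Q : Finset (Finset ι)}
    (hQ : IsSetPartitionOn (S \ s) Q) (hs : s ≠ ∅) (hsS : s ⊆ S) :
    IsSetPartitionOn S (insert s Q) := by
  refine ⟨fun t ht => ?_, fun x hx => ?_⟩
  · obtain rfl | ht := Finset.mem_insert.1 ht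
    · exact ⟨hsS, hs⟩
    · exact ⟨(hQ.1 t ht).1.trans Finset.sdiff_subset, (hQ.1 t ht).2⟩
  · by_cases hxs : x ∈ s
    · refine ⟨s, ⟨Finset.mem_insert_self _ _, hxs⟩, fun t ht => ?_⟩
      obtain rfl | htQ := Finset.mem_insert.1 ht.1
      · rfl
      · exact absurd hxs (Finset.mem_sdiff.1 ((hQ.1 t htQ).1 ht.2)).2
    · obtain ⟨t, ⟨htQ, hxt⟩, huniq⟩ := hQ.2 x (Finset.mem_sdiff.2 ⟨hx, hxs⟩)
      refine ⟨t, ⟨Finset.mem_insert_of_mem htQ, hxt⟩, fun u hu => ?_⟩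
      obtain rfl | huQ := Finset.mem_insert.1 hu.1
      · exact absurd hu.2 hxs
      · exact huniq u ⟨huQ, hu.2⟩

/-- Splitting off the first component of an ordered set partition. -/
lemma orderedPartitionSum_eq_sum {ι : Type*} [Fintype ι] [DecidableEq ι] (f : Finset ι → ℝ)
    {S : Finset ι} (hS : S.Nonempty) :
    orderedPartitionSum f S =
      ∑ T ∈ S.powerset.erase ∅, f T * orderedPartitionSum f (S \ T) := by
  unfold orderedPartitionSum
  have hl : ∀ P ∈ Finset.univ.filter (fun P : Finset (Finset ι) => IsSetPartitionOn S P),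
      (P.card ! : ℝ) * ∏ s ∈ P, f s =
        ∑ s ∈ P, f s * (((P.erase s).card ! : ℝ) * ∏ t ∈ P.erase s, f t) := by
    intro P hP
    simp only [Finset.mem_filter, Finset.mem_univ, true_and] at hP
    obtain ⟨x, hx⟩ := hS
    obtain ⟨s, ⟨hs, -⟩, -⟩ := hP.2 x hx
    have hpos : 0 < P.card := Finset.card_pos.2 ⟨s, hs⟩
    rw [Finset.sum_congr rfl (g := fun _ => ((P.card - 1)! : ℝ) * ∏ s ∈ P, f s)]
    · rw [Finset.sum_const, nsmul_eq_mul, ← mul_assoc, ← Nat.cast_mul,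
        Nat.mul_factorial_pred hpos.ne']
    · intro t ht
      rw [Finset.card_erase_of_mem ht, ← Finset.mul_prod_erase P f ht]
      ring
  rw [Finset.sum_congr rfl hl]
  simp only [Finset.mul_sum]
  rw [Finset.sum_sigma', Finset.sum_sigma']
  refine Finset.sum_bij' (fun p _ => ⟨p.2, p.1.erase p.2⟩) (fun p _ => ⟨insert p.1 p.2, p.1⟩)
    ?_ ?_ ?_ ?_ ?_
  · rintro ⟨P, s⟩ h
    simp only [Finset.mem_sigma, Finset.mem_filter, Finset.mem_univ, true_and, Finset.mem_erase,
      Finset.mem_powerset] at h ⊢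
    exact ⟨⟨(h.1.1 s h.2).2, (h.1.1 s h.2).1⟩, h.1.erase h.2⟩
  · rintro ⟨s, Q⟩ h
    simp only [Finset.mem_sigma, Finset.mem_filter, Finset.mem_univ, true_and, Finset.mem_erase,
      Finset.mem_powerset] at h ⊢
    exact ⟨h.2.insert h.1.1 h.1.2, Finset.mem_insert_self _ _⟩
  · rintro ⟨P, s⟩ h
    simp only [Finset.mem_sigma] at h
    simp only [Finset.insert_erase h.2]
  · rintro ⟨s, Q⟩ h
    simp only [Finset.mem_sigma, Finset.mem_filter, Finset.mem_univ, true_and, Finset.mem_erase,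
      Finset.mem_powerset] at h
    simp only [Finset.erase_insert (h.2.notMem_of_sdiff h.1.1)]
  · rintro ⟨P, s⟩ h
    rfl

lemma orderedPartitionSum_nonneg {ι : Type*} [Fintype ι] [DecidableEq ι] {f : Finset ι → ℝ}
    (hf : ∀ s, 0 ≤ f s) (S : Finset ι) : 0 ≤ orderedPartitionSum f S :=
  Finset.sum_nonneg fun P _ => mul_nonneg (by positivity) (Finset.prod_nonneg fun s _ => hf s)

/-- If `Q` dominates the effect of putting `x` into each possible component, then adjoining `x` to
`S` multiplies the sum over ordered partitions by at most `Q`. -/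
lemma orderedPartitionSum_insert_le {ι : Type*} [Fintype ι] [DecidableEq ι] {f : Finset ι → ℝ}
    (hf : ∀ s, 0 ≤ f s) (v : ι → ℕ) (x : ι) (p Q : ℕ → ℝ) (S : Finset ι) (hx : x ∉ S)
    (hp : ∀ T ⊆ S, T.Nonempty → f (insert x T) = f T * p (∑ i ∈ T, v i))
    (hQ0 : f {x} ≤ Q 0)
    (hQ : ∀ U ⊆ S, ∀ T ⊆ S, T.Nonempty →
      Q (∑ i ∈ U, v i) + p (∑ i ∈ T, v i) + f {x} ≤ Q (∑ i ∈ U, v i + ∑ i ∈ T, v i)) :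
    orderedPartitionSum f (insert x S) ≤ Q (∑ i ∈ S, v i) * orderedPartitionSum f S := by
  induction S using Finset.strongInduction with
  | H S ih =>
  set H := orderedPartitionSum f with hH
  set F : Finset ι → ℝ := fun T => f T * H (insert x S \ T) with hF
  have hexp : H (insert x S) = f {x} * H S + (∑ T ∈ S.powerset.erase ∅, F T +
      ∑ T ∈ S.powerset.erase ∅, F (insert x T)) := by
    rw [hH, orderedPartitionSum_eq_sum f (Finset.insert_nonempty x S)]
    have h1 := Finset.add_sum_erase (insert x S).powerset F (Finset.empty_mem_powerset _)
    rw [Finset.sum_powerset_insert hx,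
      ← Finset.add_sum_erase S.powerset F (Finset.empty_mem_powerset _),
      ← Finset.add_sum_erase S.powerset (fun T => F (insert x T)) (Finset.empty_mem_powerset _)]
      at h1
    have h2 : F (insert x ∅) = f {x} * H S := by
      simp only [hF, insert_empty_eq, Finset.insert_sdiff_of_mem S (Finset.mem_singleton_self x),
        Finset.sdiff_singleton_eq_erase, Finset.erase_eq_of_notMem hx]
    change ∑ T ∈ (insert x S).powerset.erase ∅, F T = _
    linarith
  obtain rfl | hS := S.eq_empty_or_nonempty
  · rw [hexp]
    simpa [hH, orderedPartitionSum_empty] using hQ0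
  · rw [hexp]
    have hrec : H S = ∑ T ∈ S.powerset.erase ∅, f T * H (S \ T) := orderedPartitionSum_eq_sum f hS
    rw [hrec, Finset.mul_sum, Finset.mul_sum, ← Finset.sum_add_distrib, ← Finset.sum_add_distrib]
    refine Finset.sum_le_sum fun T hT => ?_
    rw [Finset.mem_erase, Finset.mem_powerset, ← Finset.nonempty_iff_ne_empty] at hT
    obtain ⟨hT0, hTS⟩ := hT
    have hxT : x ∉ T := fun h => hx (hTS h)
    have hsub : S \ T ⊆ S := Finset.sdiff_subset
    have hlt : S \ T ⊂ S := Finset.sdiff_ssubset hTS hT0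
    have h1 := ih (S \ T) hlt (fun h => hx (hsub h)) (fun U hU => hp U (hU.trans hsub))
      (fun U hU V hV => hQ U (hU.trans hsub) V (hV.trans hsub))
    have h2 : F T = f T * H (insert x (S \ T)) := by
      simp only [hF, Finset.insert_sdiff_of_notMem S hxT]
    have h3 : F (insert x T) = f T * p (∑ i ∈ T, v i) * H (S \ T) := by
      have : insert x S \ insert x T = S \ T := by
        ext y
        simp only [Finset.mem_sdiff, Finset.mem_insert]
        grind
      simp only [hF, hp T hTS hT0, this]
    have h4 := hQ (S \ T) hsub T hTS hT0
    rw [Finset.sum_sdiff hTS] at h4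
    have hnn : 0 ≤ f T * H (S \ T) := mul_nonneg (hf T) (orderedPartitionSum_nonneg hf _)
    have h5 := mul_le_mul_of_nonneg_right h4 hnn
    have h6 := mul_le_mul_of_nonneg_left h1 (hf T)
    rw [h2, h3]
    linarith

lemma orderedPartitionSum_insert_le_of_eq_one {ι : Type*} [Fintype ι] [DecidableEq ι] (v : ι → ℕ)
    {x : ι} {S : Finset ι} (hx : x ∉ S) (hvx : v x = 1) (hv : ∀ i ∈ S, 1 ≤ v i) :
    orderedPartitionSum (fun s => 6 * ((∑ i ∈ s, v i)! : ℝ)) (insert x S) ≤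
      8 * ((∑ i ∈ S, v i : ℕ) + 1 : ℝ) *
        orderedPartitionSum (fun s => 6 * ((∑ i ∈ s, v i)! : ℝ)) S := by
  refine orderedPartitionSum_insert_le (fun s => by positivity) v x (fun y => y + 1)
    (fun y => 8 * (y + 1)) S hx (fun T hT _ => ?_) (by simp [hvx]; norm_num)
    fun U hU T hT hT0 => ?_
  · rw [Finset.sum_insert fun h => hx (hT h), hvx, add_comm, Nat.factorial_succ]
    push_cast
    ring
  · have ht : 1 ≤ ∑ i ∈ T, v i := by
      obtain ⟨i, hi⟩ := hT0
      exact (hv i (hT hi)).trans (Finset.single_le_sum (fun _ _ => Nat.zero_le _) hi)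
    have ht' : (1 : ℝ) ≤ (∑ i ∈ T, v i : ℕ) := by exact_mod_cast ht
    simp only [Finset.sum_singleton, hvx, Nat.factorial_one]
    push_cast at ht' ⊢
    linarith

/-- The growth factor for adjoining an element of weight at least `2` to a set of total weight
`y`. -/
noncomputable def insertionFactor (y : ℕ) : ℝ :=
  (y : ℝ) ^ 2 + 3 * y + if y = 0 then 12 else if y < 4 then 26 else 32

lemma insertionFactor_le (y : ℕ) : insertionFactor y ≤ (y : ℝ) ^ 2 + 3 * y + 32 := by
  unfold insertionFactor
  split_ifs <;> linarith

lemma insertionFactor_add_le {u t : ℕ} (hu : u = 0 ∨ 2 ≤ u) (ht : 2 ≤ t) :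
    insertionFactor u + ((t : ℝ) + 1) * (t + 2) + 12 ≤ insertionFactor (u + t) := by
  have ht' : (2 : ℝ) ≤ t := by exact_mod_cast ht
  unfold insertionFactor
  obtain rfl | hu := hu
  · rw [if_pos rfl, if_neg (by lia)]
    simp only [zero_add]
    split_ifs <;> push_cast <;> nlinarith
  · have hu' : (2 : ℝ) ≤ u := by exact_mod_cast hu
    rw [if_neg (by lia : ¬ u = 0), if_neg (by lia : ¬ u + t = 0), if_neg (by lia : ¬ u + t < 4)]
    push_cast
    split_ifs with h
    · nlinarith
    · have hu4 : (4 : ℝ) ≤ u := by exact_mod_cast not_lt.1 h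
      nlinarith

lemma cast_factorial_add_add_two (y w : ℕ) :
    ((y + (w + 2))! : ℝ) = (y ! : ℝ) * (((y : ℝ) + 1) * (y + 2) * ((y + 3).ascFactorial w : ℝ)) := by
  rw [show y + (w + 2) = (y + 2) + w by ring, ← Nat.factorial_mul_ascFactorial,
    Nat.factorial_succ, Nat.factorial_succ]
  push_cast
  ring

lemma orderedPartitionSum_insert_le_of_two_le {ι : Type*} [Fintype ι] [DecidableEq ι] (v : ι → ℕ)
    {x : ι} {S : Finset ι} (hx : x ∉ S) {w : ℕ} (hvx : v x = w + 2) (hv : ∀ i ∈ S, 2 ≤ v i) :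
    orderedPartitionSum (fun s => 6 * ((∑ i ∈ s, v i)! : ℝ)) (insert x S) ≤
      insertionFactor (∑ i ∈ S, v i) * ((∑ i ∈ S, v i + 3).ascFactorial w : ℝ) *
        orderedPartitionSum (fun s => 6 * ((∑ i ∈ s, v i)! : ℝ)) S := by
  have hsum : ∀ T ⊆ S, T.Nonempty → 2 ≤ ∑ i ∈ T, v i := by
    rintro T hT ⟨i, hi⟩
    exact (hv i (hT hi)).trans (Finset.single_le_sum (fun _ _ => Nat.zero_le _) hi)
  have hsingle : 6 * ((∑ i ∈ ({x} : Finset ι), v i)! : ℝ) =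
      12 * ((0 + 3).ascFactorial w : ℝ) := by
    rw [Finset.sum_singleton, hvx, ← zero_add (w + 2), cast_factorial_add_add_two]
    simp
    ring
  refine orderedPartitionSum_insert_le (fun s => by positivity) v x
    (fun y => ((y : ℝ) + 1) * (y + 2) * ((y + 3).ascFactorial w : ℝ))
    (fun y => insertionFactor y * ((y + 3).ascFactorial w : ℝ)) S hx (fun T hT _ => ?_) ?_
    fun U hU T hT hT0 => ?_
  · rw [Finset.sum_insert fun h => hx (hT h), hvx, add_comm, cast_factorial_add_add_two]
    ring
  · simp only [hsingle]
    simp [insertionFactor]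
  · simp only [hsingle]
    have ht := hsum T hT hT0
    have hu : ∑ i ∈ U, v i = 0 ∨ 2 ≤ ∑ i ∈ U, v i := by
      obtain rfl | hU0 := U.eq_empty_or_nonempty
      · simp
      · exact Or.inr (hsum U hU hU0)
    generalize ∑ i ∈ T, v i = t at ht ⊢
    generalize ∑ i ∈ U, v i = u at hu ⊢
    have hfac : 0 ≤ insertionFactor u := by
      unfold insertionFactor
      positivity
    have hmono : ∀ a ≤ u + t, ((a + 3).ascFactorial w : ℝ) ≤ ((u + t + 3).ascFactorial w : ℝ) :=
      fun a ha => by exact_mod_cast Nat.ascFactorial_le w (by lia : a + 3 ≤ u + t + 3)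
    calc _ ≤ insertionFactor u * ((u + t + 3).ascFactorial w : ℝ) +
          ((t : ℝ) + 1) * (t + 2) * ((u + t + 3).ascFactorial w : ℝ) +
          12 * ((u + t + 3).ascFactorial w : ℝ) := by
          gcongr <;> lia
      _ = (insertionFactor u + ((t : ℝ) + 1) * (t + 2) + 12) *
          ((u + t + 3).ascFactorial w : ℝ) := by ring
      _ ≤ _ := mul_le_mul_of_nonneg_right (insertionFactor_add_le hu ht) (by positivity)

lemma insertionFactor_mul_pow_le {n M : ℕ} (hn : 1 ≤ n) (hM : 2 * n ≤ M) :
    insertionFactor M * ((n : ℝ) / (n + 1)) ^ 9 ≤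
      ((M : ℝ) + 1) * (M + 2) * (((n + 1 : ℕ) : ℝ) / ((n + 1 : ℕ) + 1)) ^ 9 := by
  have hn' : (1 : ℝ) ≤ n := by exact_mod_cast hn
  have hM' : 2 * (n : ℝ) ≤ M := by exact_mod_cast hM
  have hratio : (((n + 1 : ℕ) : ℝ) / ((n + 1 : ℕ) + 1)) ^ 9 =
      (1 + 1 / ((n : ℝ) * (n + 2))) ^ 9 * ((n : ℝ) / (n + 1)) ^ 9 := by
    rw [← mul_pow]
    congr 1
    push_cast
    field_simp
    ring
  have hbern : 1 + (9 : ℕ) * (1 / ((n : ℝ) * (n + 2))) ≤ (1 + 1 / ((n : ℝ) * (n + 2))) ^ 9 :=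
    one_add_mul_le_pow (by linarith [show 0 ≤ 1 / ((n : ℝ) * (n + 2)) by positivity]) 9
  rw [hratio, ← mul_assoc]
  refine mul_le_mul_of_nonneg_right ?_ (by positivity)
  refine le_trans ?_ (mul_le_mul_of_nonneg_left hbern (by positivity))
  refine (insertionFactor_le M).trans ?_
  have hkey : 30 ≤ ((M : ℝ) + 1) * (M + 2) * (9 / ((n : ℝ) * (n + 2))) := by
    rw [← mul_div_assoc, le_div_iff₀ (by positivity)]
    nlinarith
  push_cast
  have : ((M : ℝ) + 1) * (M + 2) * (1 + 9 * (1 / ((n : ℝ) * (n + 2)))) =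
    ((M : ℝ) + 1) * (M + 2) + ((M : ℝ) + 1) * (M + 2) * (9 / ((n : ℝ) * (n + 2))) := by ring
  rw [this]
  linarith

lemma orderedPartitionSum_le_of_two_le {ι : Type*} [Fintype ι] [DecidableEq ι] (v : ι → ℕ)
    (S : Finset ι) (hv : ∀ i ∈ S, 2 ≤ v i) :
    orderedPartitionSum (fun s => 6 * ((∑ i ∈ s, v i)! : ℝ)) S ≤
      3072 * ((∑ i ∈ S, v i)! : ℝ) := by
  suffices h : S.Nonempty → orderedPartitionSum (fun s => 6 * ((∑ i ∈ s, v i)! : ℝ)) S ≤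
      3072 * ((S.card : ℝ) / (S.card + 1)) ^ 9 * ((∑ i ∈ S, v i)! : ℝ) by
    obtain rfl | hS := S.eq_empty_or_nonempty
    · simp [orderedPartitionSum_empty]
    · refine (h hS).trans (mul_le_mul_of_nonneg_right ?_ (by positivity))
      refine mul_le_of_le_one_right (by norm_num) (pow_le_one₀ (by positivity) ?_)
      exact div_le_one_of_le₀ (by linarith) (by positivity)
  intro hS
  induction S using Finset.induction with
  | empty => simp at hS
  | insert x S hx ih =>
  obtain ⟨w, hw⟩ := Nat.exists_eq_add_of_le' (hv x (Finset.mem_insert_self x S))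
  have hvS : ∀ i ∈ S, 2 ≤ v i := fun i hi => hv i (Finset.mem_insert_of_mem hi)
  refine (orderedPartitionSum_insert_le_of_two_le v hx hw hvS).trans ?_
  rw [Finset.card_insert_of_notMem hx, Finset.sum_insert hx, hw, add_comm (w + 2),
    cast_factorial_add_add_two]
  obtain rfl | hS0 := S.eq_empty_or_nonempty
  · rw [orderedPartitionSum_empty]
    simp [insertionFactor]
    apply le_of_eq
    ring
  · have hM : 2 * S.card ≤ ∑ i ∈ S, v i := by
      simpa [mul_comm] using Finset.card_nsmul_le_sum S v 2 hvS
    have hfac := insertionFactor_mul_pow_le hS0.card_pos hM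
    have hnn : 0 ≤ insertionFactor (∑ i ∈ S, v i) := by
      unfold insertionFactor
      positivity
    generalize ∑ i ∈ S, v i = M at *
    calc _ ≤ insertionFactor M * ((M + 3).ascFactorial w : ℝ) *
          (3072 * ((S.card : ℝ) / (S.card + 1)) ^ 9 * (M ! : ℝ)) :=
          mul_le_mul_of_nonneg_left (ih hvS hS0) (by positivity)
      _ = (insertionFactor M * ((S.card : ℝ) / (S.card + 1)) ^ 9) *
          (3072 * (M ! : ℝ) * ((M + 3).ascFactorial w : ℝ)) := by ring
      _ ≤ _ := mul_le_mul_of_nonneg_right hfac (by positivity)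
      _ = _ := by ring

lemma orderedPartitionSum_union_le_of_eq_one {ι : Type*} [Fintype ι] [DecidableEq ι] (v : ι → ℕ)
    (O S : Finset ι) (hO : ∀ i ∈ O, v i = 1) (hS : ∀ i ∈ S, 2 ≤ v i) :
    orderedPartitionSum (fun s => 6 * ((∑ i ∈ s, v i)! : ℝ)) (O ∪ S) ≤
      3072 * 8 ^ O.card * ((∑ i ∈ O ∪ S, v i)! : ℝ) := by
  induction O using Finset.induction with
  | empty => simpa using orderedPartitionSum_le_of_two_le v S hS
  | insert x O hx ih =>
  have hvx := hO x (Finset.mem_insert_self x O)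
  have hO' : ∀ i ∈ O, v i = 1 := fun i hi => hO i (Finset.mem_insert_of_mem hi)
  have hxS : x ∉ S := fun h => by
    have := hS x h
    lia
  have hxU : x ∉ O ∪ S := by simp [hx, hxS]
  have hv : ∀ i ∈ O ∪ S, 1 ≤ v i := fun i hi => by
    obtain hi | hi := Finset.mem_union.1 hi
    · exact (hO' i hi).ge
    · exact one_le_two.trans (hS i hi)
  rw [Finset.insert_union, Finset.card_insert_of_notMem hx, Finset.sum_insert hxU, hvx, add_comm 1,
    Nat.factorial_succ]
  refine (orderedPartitionSum_insert_le_of_eq_one v hxU hvx hv).trans ?_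
  refine (mul_le_mul_of_nonneg_left (ih hO') (by positivity)).trans (le_of_eq ?_)
  push_cast
  ring

/-- Let `k ≤ n` be positive integers and `m = (m₁, …, m_n)` an
`n`-tuple of positive integers with at most `k` parts equal to `1`.  Then
`|E(m)| ≤ 2^{78k} · |m|!`. -/
theorem abs_Emap_le_of_few_ones (n k : ℕ) (hk : 0 < k) (hkn : k ≤ n)
    (m : Fin n → ℕ) (hm : ∀ i, 0 < m i)
    (hones : (Finset.univ.filter fun i => m i = 1).card ≤ k) :
    |Emap Finset.univ m| ≤ 2 ^ (78 * k) * ((∑ i, m i)! : ℝ) := by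
  have hcover : (Finset.univ.filter fun i => m i = 1) ∪ (Finset.univ.filter fun i => ¬ m i = 1) =
      Finset.univ := Finset.filter_union_filter_not_eq _ _
  have h := orderedPartitionSum_union_le_of_eq_one m (Finset.univ.filter fun i => m i = 1)
    (Finset.univ.filter fun i => ¬ m i = 1) (fun i hi => (Finset.mem_filter.1 hi).2) fun i hi => by
      have h1 := (Finset.mem_filter.1 hi).2
      have h2 := hm i
      lia
  rw [hcover] at h
  refine (abs_Emap_le_orderedPartitionSum Finset.univ m).trans (h.trans ?_)
  refine mul_le_mul_of_nonneg_right ?_ (by positivity)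
  calc (3072 : ℝ) * 8 ^ (Finset.univ.filter fun i => m i = 1).card ≤ 2 ^ 12 * 8 ^ k :=
        mul_le_mul (by norm_num) (pow_le_pow_right₀ (by norm_num) hones) (by positivity)
          (by positivity)
    _ = 2 ^ (12 + 3 * k) := by
        rw [pow_add, pow_mul (2 : ℝ) 3 k]
        norm_num
    _ ≤ 2 ^ (78 * k) := pow_le_pow_right₀ one_le_two (by lia)
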